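/- Let (E,P) be a series-parallel routing network with continuous, nonnegative, nondecreasing edge costs. Then there exists a family (f(μ))_{μ ≥ 0} of Wardrop equilibria (one for each demand μ) such that for every edge e the load μ ↦ x_e(f(μ)) is nondecreasing in μ; moreover the active network μ ↦ Ẽ(μ) is nondecreasing with respect to inclusion on (0,∞), and the number of Ẽ-breakpoints is at most min(|P|, |E|). -/

import Mathlib

open Finset Set

noncomputable section

variable {α : Type*}

/-- Load induced on edge `e` by the path-flow `f` over the path collection `P`. -/
def sLoad [DecidableEq α] (P : Finset (Finset α)) (f : Finset α → ℝ) (e : α) : ℝ :=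
  ∑ p ∈ P, if e ∈ p then f p else 0

/-- Feasibility of a flow for demand `μ`. -/
def sFeasible (P : Finset (Finset α)) (f : Finset α → ℝ) (μ : ℝ) : Prop :=
  (∀ p ∈ P, 0 ≤ f p) ∧ ∑ p ∈ P, f p = μ

/-- Cost of path `p` under flow `f`. -/
def sPathCost [DecidableEq α] (P : Finset (Finset α)) (c : α → ℝ → ℝ)
    (f : Finset α → ℝ) (p : Finset α) : ℝ :=
  ∑ e ∈ p, c e (sLoad P f e)

/-- Wardrop equilibrium with equilibrium cost `lam` at demand `μ`. -/
def sIsWardrop [DecidableEq α] (P : Finset (Finset α)) (c : α → ℝ → ℝ)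
    (μ : ℝ) (f : Finset α → ℝ) (lam : ℝ) : Prop :=
  sFeasible P f μ ∧ (∀ p ∈ P, 0 < f p → sPathCost P c f p = lam) ∧
    ∀ p ∈ P, lam ≤ sPathCost P c f p

/-- The active network: edges lying on some path of minimal cost `lam`. -/
def sActive [DecidableEq α] (P : Finset (Finset α)) (c : α → ℝ → ℝ)
    (f : Finset α → ℝ) (lam : ℝ) : Set α :=
  {e | ∃ p ∈ P, sPathCost P c f p = lam ∧ e ∈ p}

/-- `μ₀` is a breakpoint of the active-network map `Act`. -/
def IsBreakpoint (Act : ℝ → Set α) (μ₀ : ℝ) : Prop :=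
  0 < μ₀ ∧ ∃ ε > 0,
    (∀ μ ∈ Set.Ico (μ₀ - ε) μ₀, Act μ = Act (μ₀ - ε)) ∧
    (∀ μ ∈ Set.Ioc μ₀ (μ₀ + ε), Act μ = Act (μ₀ + ε)) ∧
    Act (μ₀ - ε) ≠ Act (μ₀ + ε)

/-- Series-parallel networks, built from single edges by series and parallel composition
of networks with disjoint edge sets. -/
inductive IsSP [DecidableEq α] : Finset α → Finset (Finset α) → Prop
  | base (e : α) : IsSP {e} {{e}}
  | series {E₁ E₂ : Finset α} {P₁ P₂ : Finset (Finset α)} :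
      IsSP E₁ P₁ → IsSP E₂ P₂ → Disjoint E₁ E₂ →
      IsSP (E₁ ∪ E₂) ((P₁ ×ˢ P₂).image fun q => q.1 ∪ q.2)
  | parallel {E₁ E₂ : Finset α} {P₁ P₂ : Finset (Finset α)} :
      IsSP E₁ P₁ → IsSP E₂ P₂ → Disjoint E₁ E₂ →
      IsSP (E₁ ∪ E₂) (P₁ ∪ P₂)

theorem IsSP.subset_and_nonempty [DecidableEq α] {E : Finset α} {P : Finset (Finset α)}
    (h : IsSP E P) : ∀ p ∈ P, p ⊆ E ∧ p.Nonempty := by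
  induction h with
  | base e => simp
  | @series E₁ E₂ P₁ P₂ _ _ _ ih₁ ih₂ =>
    intro p hp
    obtain ⟨⟨p₁, p₂⟩, hq, rfl⟩ := Finset.mem_image.1 hp
    obtain ⟨h₁, h₂⟩ := Finset.mem_product.1 hq
    exact ⟨Finset.union_subset_union (ih₁ _ h₁).1 (ih₂ _ h₂).1, (ih₁ _ h₁).2.inl⟩
  | @parallel E₁ E₂ P₁ P₂ _ _ _ ih₁ ih₂ =>
    intro p hp
    rcases Finset.mem_union.1 hp with h | h
    · exact ⟨(ih₁ _ h).1.trans Finset.subset_union_left, (ih₁ _ h).2⟩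
    · exact ⟨(ih₂ _ h).1.trans Finset.subset_union_right, (ih₂ _ h).2⟩

/-- A demand `max μ 0` can be split between two alternatives with continuous nondecreasing
costs so that both shares depend monotonically and continuously on `μ`, and every alternative
with a positive share is cheapest. -/
theorem exists_monotone_split {L₁ L₂ : ℝ → ℝ} (hm₁ : Monotone L₁) (hm₂ : Monotone L₂)
    (hc₁ : Continuous L₁) (hc₂ : Continuous L₂) :
    ∃ s t : ℝ → ℝ, Monotone s ∧ Monotone t ∧ Continuous s ∧ Continuous t ∧
      (∀ μ, 0 ≤ s μ) ∧ (∀ μ, 0 ≤ t μ) ∧ (∀ μ, s μ + t μ = max μ 0) ∧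
      (∀ μ, 0 < s μ → L₁ (s μ) ≤ L₂ (t μ)) ∧ (∀ μ, 0 < t μ → L₂ (t μ) ≤ L₁ (s μ)) := by
  let S : ℝ → Set ℝ := fun m => Set.Icc 0 m ∩ ({0} ∪ {x | L₁ x ≤ L₂ (m - x)})
  have greatest : ∀ μ : ℝ, ∃ s, IsGreatest (S (max μ 0)) s := by
    intro μ
    refine IsCompact.exists_isGreatest (isCompact_Icc.inter_right ?_) ⟨0, by simp, by simp⟩
    exact isClosed_singleton.union (isClosed_le hc₁ (by fun_prop))
  choose s hs using greatest
  have hs_mem : ∀ μ, (0 ≤ s μ ∧ s μ ≤ max μ 0) ∧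
      (s μ = 0 ∨ L₁ (s μ) ≤ L₂ (max μ 0 - s μ)) := fun μ => (hs μ).1
  have hs_le : ∀ μ x, 0 ≤ x → x ≤ max μ 0 → (x = 0 ∨ L₁ x ≤ L₂ (max μ 0 - x)) → x ≤ s μ :=
    fun μ x h0 h1 h2 => (hs μ).2 ⟨⟨h0, h1⟩, h2⟩
  have hs_mono : Monotone s := by
    intro μ ν h
    have hmax : max μ 0 ≤ max ν 0 := max_le_max_right 0 h
    obtain ⟨⟨h0, h1⟩, h2⟩ := hs_mem μ
    refine hs_le ν _ h0 (h1.trans hmax) (h2.imp id fun h2 => h2.trans (hm₂ (by linarith)))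
  have ht_mono : Monotone fun μ => max μ 0 - s μ := by
    intro μ ν h
    have hmax : max μ 0 ≤ max ν 0 := max_le_max_right 0 h
    obtain ⟨⟨h0, h1⟩, h2⟩ := hs_mem ν
    change max μ 0 - s μ ≤ max ν 0 - s ν
    rcases le_total (s ν - (max ν 0 - max μ 0)) 0 with hneg | hpos
    · have := (hs_mem μ).1.1
      linarith
    · suffices s ν - (max ν 0 - max μ 0) ≤ s μ by linarith
      refine hs_le μ _ hpos (by linarith) ?_
      rcases h2 with h2 | h2
      · left; linarith
      · right
        refine (hm₁ (by linarith)).trans (h2.trans (hm₂ (by linarith)))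
  have hs_cont : Continuous s := by
    refine (LipschitzWith.of_le_add fun μ ν => ?_).continuous
    rcases le_total μ ν with h | h
    · have := hs_mono h
      have := dist_nonneg (x := μ) (y := ν)
      linarith
    · have h1 := ht_mono h
      have h2 : max μ 0 - max ν 0 ≤ μ - ν := by
        rcases le_total ν 0 with h3 | h3 <;> rcases le_total μ 0 with h4 | h4 <;>
          simp only [max_eq_left, max_eq_right, h3, h4] <;> linarith
      have h3 := le_abs_self (μ - ν)
      simp only [Real.dist_eq] at *
      linarith
  refine ⟨s, fun μ => max μ 0 - s μ, hs_mono, ht_mono, hs_cont, by fun_prop,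
    fun μ => (hs_mem μ).1.1, fun μ => sub_nonneg.2 (hs_mem μ).1.2, fun μ => by ring,
    fun μ h => (hs_mem μ).2.resolve_left h.ne', fun μ h => ?_⟩
  by_contra! hlt
  have hlt' : ∀ᶠ x in nhdsWithin (s μ) (Set.Ioi (s μ)), L₁ x < L₂ (max μ 0 - x) :=
    nhdsWithin_le_nhds ((isOpen_lt hc₁ (by fun_prop)).mem_nhds hlt)
  obtain ⟨x, hx, hx1, hx2⟩ := (hlt'.and (Ioo_mem_nhdsGT (sub_pos.1 h))).exists
  exact absurd (hs_le μ x ((hs_mem μ).1.1.trans hx1.le) hx2.le (Or.inr hx.le)) (not_le.2 hx1)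

/-- A family of Wardrop equilibria `f μ` for the demands `max μ 0`, with minimal path costs
`L μ`, whose edge loads, minimal cost and set of cheapest paths are nondecreasing in `μ`. -/
structure IsMonotoneFamily [DecidableEq α] (E : Finset α) (P : Finset (Finset α))
    (c : α → ℝ → ℝ) (f : ℝ → Finset α → ℝ) (L : ℝ → ℝ) : Prop where
  wardrop : ∀ μ, sIsWardrop P c (max μ 0) (f μ) (L μ)
  load_mono : ∀ e ∈ E, Monotone fun μ => sLoad P (f μ) e
  load_cont : ∀ e ∈ E, Continuous fun μ => sLoad P (f μ) e
  cost_mono : Monotone L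
  cost_cont : Continuous L
  tight : ∀ μ, ∃ p ∈ P, sPathCost P c (f μ) p = L μ
  active_mono : ∀ p ∈ P, ∀ μ ν, μ ≤ ν → sPathCost P c (f μ) p = L μ →
    sPathCost P c (f ν) p = L ν

theorem IsMonotoneFamily.base [DecidableEq α] (e : α) (c : α → ℝ → ℝ)
    (hcont : Continuous (c e)) (hmono : Monotone (c e)) :
    IsMonotoneFamily {e} {{e}} c (fun μ _ => max μ 0) (fun μ => c e (max μ 0)) where
  wardrop μ := by
    simp [sIsWardrop, sFeasible, sPathCost, sLoad]
  load_mono := by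
    simp only [sLoad, Finset.mem_singleton, forall_eq, Finset.sum_singleton, if_true]
    exact fun μ ν h => max_le_max_right 0 h
  load_cont := by
    simp only [sLoad, Finset.mem_singleton, forall_eq, Finset.sum_singleton, if_true]
    fun_prop
  cost_mono := hmono.comp fun μ ν h => max_le_max_right 0 h
  cost_cont := by fun_prop
  tight μ := by simp [sPathCost, sLoad]
  active_mono := by simp [sPathCost, sLoad]

theorem sLoad_eq_zero_of_notMem [DecidableEq α] {E : Finset α} {P : Finset (Finset α)}
    (hP : ∀ p ∈ P, p ⊆ E) (f : Finset α → ℝ) {e : α} (he : e ∉ E) : sLoad P f e = 0 :=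
  Finset.sum_eq_zero fun p hp => if_neg fun h => he (hP p hp h)

theorem sLoad_congr [DecidableEq α] {P : Finset (Finset α)} {f g : Finset α → ℝ}
    (h : ∀ p ∈ P, f p = g p) (e : α) : sLoad P f e = sLoad P g e :=
  Finset.sum_congr rfl fun p hp => by rw [h p hp]

theorem disjoint_paths {E₁ E₂ : Finset α} {P₁ P₂ : Finset (Finset α)}
    (hE : Disjoint E₁ E₂) (h₁ : ∀ p ∈ P₁, p ⊆ E₁ ∧ p.Nonempty)
    (h₂ : ∀ p ∈ P₂, p ⊆ E₂) : Disjoint P₁ P₂ := by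
  refine Finset.disjoint_left.2 fun p hp₁ hp₂ => ?_
  obtain ⟨e, he⟩ := (h₁ p hp₁).2
  exact Finset.disjoint_left.1 hE ((h₁ p hp₁).1 he) (h₂ p hp₂ he)

theorem sFeasible.eq_zero {P : Finset (Finset α)} {f : Finset α → ℝ} (h : sFeasible P f 0) :
    ∀ p ∈ P, f p = 0 :=
  (Finset.sum_eq_zero_iff_of_nonneg h.1).1 h.2

theorem sFeasible.mul_div_self {P : Finset (Finset α)} {f : Finset α → ℝ} {m : ℝ}
    (h : sFeasible P f m) {p : Finset α} (hp : p ∈ P) : f p * m / m = f p := by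
  rcases eq_or_ne m 0 with rfl | hm
  · simp [h.eq_zero p hp]
  · field_simp

section Parallel

variable [DecidableEq α] {E₁ E₂ : Finset α} {P₁ P₂ : Finset (Finset α)}

/-- The flow on a parallel composition that agrees with `f₁` on `P₁` and with `f₂` on the
remaining paths. -/
def parallelFlow (P₁ : Finset (Finset α)) (f₁ f₂ : Finset α → ℝ) (p : Finset α) : ℝ :=
  if p ∈ P₁ then f₁ p else f₂ p

theorem parallelFlow_left {p : Finset α} (hp : p ∈ P₁) (f₁ f₂ : Finset α → ℝ) :
    parallelFlow P₁ f₁ f₂ p = f₁ p := if_pos hp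

theorem parallelFlow_right (hP : Disjoint P₁ P₂) {p : Finset α} (hp : p ∈ P₂)
    (f₁ f₂ : Finset α → ℝ) : parallelFlow P₁ f₁ f₂ p = f₂ p :=
  if_neg (Finset.disjoint_right.1 hP hp)

theorem sLoad_parallel (hP : Disjoint P₁ P₂) (f₁ f₂ : Finset α → ℝ) (e : α) :
    sLoad (P₁ ∪ P₂) (parallelFlow P₁ f₁ f₂) e = sLoad P₁ f₁ e + sLoad P₂ f₂ e := by
  rw [← sLoad_congr (fun p hp => parallelFlow_left hp f₁ f₂) e,
    ← sLoad_congr (fun p hp => parallelFlow_right hP hp f₁ f₂) e]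
  exact Finset.sum_union hP

theorem sLoad_parallel_left (hE : Disjoint E₁ E₂) (h₂ : ∀ p ∈ P₂, p ⊆ E₂)
    (hP : Disjoint P₁ P₂) (f₁ f₂ : Finset α → ℝ) {e : α} (he : e ∈ E₁) :
    sLoad (P₁ ∪ P₂) (parallelFlow P₁ f₁ f₂) e = sLoad P₁ f₁ e := by
  rw [sLoad_parallel hP, sLoad_eq_zero_of_notMem h₂ f₂ (Finset.disjoint_left.1 hE he), add_zero]

theorem sLoad_parallel_right (hE : Disjoint E₁ E₂) (h₁ : ∀ p ∈ P₁, p ⊆ E₁)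
    (hP : Disjoint P₁ P₂) (f₁ f₂ : Finset α → ℝ) {e : α} (he : e ∈ E₂) :
    sLoad (P₁ ∪ P₂) (parallelFlow P₁ f₁ f₂) e = sLoad P₂ f₂ e := by
  rw [sLoad_parallel hP, sLoad_eq_zero_of_notMem h₁ f₁ (Finset.disjoint_right.1 hE he), zero_add]

theorem IsMonotoneFamily.parallel {c : α → ℝ → ℝ} {f₁ f₂ : ℝ → Finset α → ℝ} {L₁ L₂ : ℝ → ℝ}
    (hE : Disjoint E₁ E₂) (h₁ : ∀ p ∈ P₁, p ⊆ E₁ ∧ p.Nonempty)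
    (h₂ : ∀ p ∈ P₂, p ⊆ E₂ ∧ p.Nonempty)
    (H₁ : IsMonotoneFamily E₁ P₁ c f₁ L₁) (H₂ : IsMonotoneFamily E₂ P₂ c f₂ L₂) :
    ∃ f L, IsMonotoneFamily (E₁ ∪ E₂) (P₁ ∪ P₂) c f L := by
  have hP : Disjoint P₁ P₂ := disjoint_paths hE h₁ fun p hp => (h₂ p hp).1
  obtain ⟨s, t, hs, ht, hsc, htc, hs0, ht0, hst, hs_le, ht_le⟩ :=
    exists_monotone_split H₁.cost_mono H₂.cost_mono H₁.cost_cont H₂.cost_cont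
  set f : ℝ → Finset α → ℝ := fun μ => parallelFlow P₁ (f₁ (s μ)) (f₂ (t μ)) with hf
  set L : ℝ → ℝ := fun μ => min (L₁ (s μ)) (L₂ (t μ)) with hL
  have load₁ : ∀ e ∈ E₁, ∀ μ, sLoad (P₁ ∪ P₂) (f μ) e = sLoad P₁ (f₁ (s μ)) e :=
    fun e he μ => sLoad_parallel_left hE (fun p hp => (h₂ p hp).1) hP _ _ he
  have load₂ : ∀ e ∈ E₂, ∀ μ, sLoad (P₁ ∪ P₂) (f μ) e = sLoad P₂ (f₂ (t μ)) e :=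
    fun e he μ => sLoad_parallel_right hE (fun p hp => (h₁ p hp).1) hP _ _ he
  have cost₁ : ∀ p ∈ P₁, ∀ μ,
      sPathCost (P₁ ∪ P₂) c (f μ) p = sPathCost P₁ c (f₁ (s μ)) p := fun p hp μ =>
    Finset.sum_congr rfl fun e he => by rw [load₁ e ((h₁ p hp).1 he)]
  have cost₂ : ∀ p ∈ P₂, ∀ μ,
      sPathCost (P₁ ∪ P₂) c (f μ) p = sPathCost P₂ c (f₂ (t μ)) p := fun p hp μ =>
    Finset.sum_congr rfl fun e he => by rw [load₂ e ((h₂ p hp).1 he)]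
  have hLmono : Monotone L := fun μ ν h =>
    min_le_min (H₁.cost_mono (hs h)) (H₂.cost_mono (ht h))
  have hLs : ∀ μ, 0 < s μ → L μ = L₁ (s μ) := fun μ h => min_eq_left (hs_le μ h)
  have hLt : ∀ μ, 0 < t μ → L μ = L₂ (t μ) := fun μ h => min_eq_right (ht_le μ h)
  -- An alternative that is cheapest stays so: it either carries flow or its share is still zero.
  have act₁ : ∀ μ ν, μ ≤ ν → L μ = L₁ (s μ) → L ν = L₁ (s ν) := by
    intro μ ν h hμ
    rcases (hs0 ν).lt_or_eq with h0 | h0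
    · exact hLs ν h0
    · have : s μ = s ν := le_antisymm (hs h) (h0 ▸ hs0 μ)
      exact le_antisymm (min_le_left _ _) (this ▸ hμ ▸ hLmono h)
  have act₂ : ∀ μ ν, μ ≤ ν → L μ = L₂ (t μ) → L ν = L₂ (t ν) := by
    intro μ ν h hμ
    rcases (ht0 ν).lt_or_eq with h0 | h0
    · exact hLt ν h0
    · have : t μ = t ν := le_antisymm (ht h) (h0 ▸ ht0 μ)
      exact le_antisymm (min_le_right _ _) (this ▸ hμ ▸ hLmono h)
  have nonneg₁ : ∀ μ, ∀ p ∈ P₁, 0 ≤ f₁ μ p := fun μ => (H₁.wardrop μ).1.1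
  have nonneg₂ : ∀ μ, ∀ p ∈ P₂, 0 ≤ f₂ μ p := fun μ => (H₂.wardrop μ).1.1
  have sum₁ : ∀ μ, ∑ p ∈ P₁, f₁ (s μ) p = s μ := fun μ => by
    rw [(H₁.wardrop (s μ)).1.2, max_eq_left (hs0 μ)]
  have sum₂ : ∀ μ, ∑ p ∈ P₂, f₂ (t μ) p = t μ := fun μ => by
    rw [(H₂.wardrop (t μ)).1.2, max_eq_left (ht0 μ)]
  refine ⟨f, L, ?_, ?_, ?_, hLmono, ?_, ?_, ?_⟩
  · intro μ
    refine ⟨⟨fun p hp => ?_, ?_⟩, fun p hp hpos => ?_, fun p hp => ?_⟩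
    · rcases Finset.mem_union.1 hp with h | h
      · exact (parallelFlow_left h _ _).ge.trans' (nonneg₁ _ p h)
      · exact (parallelFlow_right hP h _ _).ge.trans' (nonneg₂ _ p h)
    · rw [Finset.sum_union hP, Finset.sum_congr rfl fun p hp => parallelFlow_left hp _ _,
        Finset.sum_congr rfl fun p hp => parallelFlow_right hP hp _ _, sum₁, sum₂, hst]
    · rcases Finset.mem_union.1 hp with h | h
      · have hpos' : 0 < f₁ (s μ) p := hpos.trans_eq (parallelFlow_left h _ _)
        have : 0 < s μ := sum₁ μ ▸ hpos'.trans_le (Finset.single_le_sum (nonneg₁ _) h)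
        rw [cost₁ p h, hLs μ this, (H₁.wardrop (s μ)).2.1 p h hpos']
      · have hpos' : 0 < f₂ (t μ) p := hpos.trans_eq (parallelFlow_right hP h _ _)
        have : 0 < t μ := sum₂ μ ▸ hpos'.trans_le (Finset.single_le_sum (nonneg₂ _) h)
        rw [cost₂ p h, hLt μ this, (H₂.wardrop (t μ)).2.1 p h hpos']
    · rcases Finset.mem_union.1 hp with h | h
      · exact cost₁ p h μ ▸ (min_le_left _ _).trans ((H₁.wardrop _).2.2 p h)
      · exact cost₂ p h μ ▸ (min_le_right _ _).trans ((H₂.wardrop _).2.2 p h)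
  · intro e he
    rcases Finset.mem_union.1 he with h | h
    · simp only [load₁ e h]
      exact (H₁.load_mono e h).comp hs
    · simp only [load₂ e h]
      exact (H₂.load_mono e h).comp ht
  · intro e he
    rcases Finset.mem_union.1 he with h | h
    · simp only [load₁ e h]
      exact (H₁.load_cont e h).comp hsc
    · simp only [load₂ e h]
      exact (H₂.load_cont e h).comp htc
  · exact (H₁.cost_cont.comp hsc).min (H₂.cost_cont.comp htc)
  · intro μ
    rcases min_choice (L₁ (s μ)) (L₂ (t μ)) with h | h
    · obtain ⟨p, hp, hpL⟩ := H₁.tight (s μ)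
      exact ⟨p, Finset.mem_union_left _ hp, by rw [cost₁ p hp, hpL, hL]; exact h.symm⟩
    · obtain ⟨p, hp, hpL⟩ := H₂.tight (t μ)
      exact ⟨p, Finset.mem_union_right _ hp, by rw [cost₂ p hp, hpL, hL]; exact h.symm⟩
  · intro p hp μ ν h hμ
    rcases Finset.mem_union.1 hp with hp' | hp'
    · rw [cost₁ p hp'] at hμ ⊢
      have hle := (H₁.wardrop (s μ)).2.2 p hp'
      have hLμ : L μ = L₁ (s μ) := le_antisymm (min_le_left _ _) (hμ ▸ hle)
      rw [act₁ μ ν h hLμ, H₁.active_mono p hp' _ _ (hs h) (hμ.trans hLμ)]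
    · rw [cost₂ p hp'] at hμ ⊢
      have hle := (H₂.wardrop (t μ)).2.2 p hp'
      have hLμ : L μ = L₂ (t μ) := le_antisymm (min_le_right _ _) (hμ ▸ hle)
      rw [act₂ μ ν h hLμ, H₂.active_mono p hp' _ _ (ht h) (hμ.trans hLμ)]

end Parallel

section Series

variable [DecidableEq α] {E₁ E₂ : Finset α} {P₁ P₂ : Finset (Finset α)}

theorem union_inter_left_of_subset (hE : Disjoint E₁ E₂) {p₁ p₂ : Finset α} (h₁ : p₁ ⊆ E₁)
    (h₂ : p₂ ⊆ E₂) : (p₁ ∪ p₂) ∩ E₁ = p₁ := by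
  rw [Finset.union_inter_distrib_right, Finset.inter_eq_left.2 h₁,
    Finset.disjoint_iff_inter_eq_empty.1 (hE.symm.mono_left h₂), Finset.union_empty]

theorem union_inter_right_of_subset (hE : Disjoint E₁ E₂) {p₁ p₂ : Finset α} (h₁ : p₁ ⊆ E₁)
    (h₂ : p₂ ⊆ E₂) : (p₁ ∪ p₂) ∩ E₂ = p₂ := by
  rw [Finset.union_comm, union_inter_left_of_subset hE.symm h₂ h₁]

theorem sum_series_paths (hE : Disjoint E₁ E₂) (h₁ : ∀ p ∈ P₁, p ⊆ E₁) (h₂ : ∀ p ∈ P₂, p ⊆ E₂)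
    (g : Finset α → ℝ) :
    ∑ p ∈ (P₁ ×ˢ P₂).image (fun q => q.1 ∪ q.2), g p = ∑ p₁ ∈ P₁, ∑ p₂ ∈ P₂, g (p₁ ∪ p₂) := by
  rw [Finset.sum_image, Finset.sum_product]
  rintro ⟨p₁, p₂⟩ hp ⟨q₁, q₂⟩ hq h
  simp only [Finset.coe_product, Set.mem_prod, Finset.mem_coe] at hp hq h
  refine Prod.ext ?_ ?_
  · change p₁ = q₁
    rw [← union_inter_left_of_subset hE (h₁ _ hp.1) (h₂ _ hp.2), h,
      union_inter_left_of_subset hE (h₁ _ hq.1) (h₂ _ hq.2)]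
  · change p₂ = q₂
    rw [← union_inter_right_of_subset hE (h₁ _ hp.1) (h₂ _ hp.2), h,
      union_inter_right_of_subset hE (h₁ _ hq.1) (h₂ _ hq.2)]

/-- The product coupling of two flows of the same value `m` on a series composition. -/
def seriesFlow (E₁ E₂ : Finset α) (m : ℝ) (f₁ f₂ : Finset α → ℝ) (p : Finset α) : ℝ :=
  f₁ (p ∩ E₁) * f₂ (p ∩ E₂) / m

theorem seriesFlow_union (hE : Disjoint E₁ E₂) {p₁ p₂ : Finset α} (h₁ : p₁ ⊆ E₁)
    (h₂ : p₂ ⊆ E₂) (m : ℝ) (f₁ f₂ : Finset α → ℝ) :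
    seriesFlow E₁ E₂ m f₁ f₂ (p₁ ∪ p₂) = f₁ p₁ * f₂ p₂ / m := by
  rw [seriesFlow, union_inter_left_of_subset hE h₁ h₂, union_inter_right_of_subset hE h₁ h₂]

theorem sum_seriesFlow_right (hE : Disjoint E₁ E₂) (h₂ : ∀ p ∈ P₂, p ⊆ E₂) {m : ℝ}
    {f₁ f₂ : Finset α → ℝ} (F₁ : sFeasible P₁ f₁ m) (F₂ : sFeasible P₂ f₂ m)
    {p₁ : Finset α} (hp₁ : p₁ ∈ P₁) (hp₁E : p₁ ⊆ E₁) :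
    ∑ p₂ ∈ P₂, seriesFlow E₁ E₂ m f₁ f₂ (p₁ ∪ p₂) = f₁ p₁ := by
  rw [Finset.sum_congr rfl fun p₂ hp₂ => seriesFlow_union hE hp₁E (h₂ p₂ hp₂) m f₁ f₂,
    ← Finset.sum_div, ← Finset.mul_sum, F₂.2, F₁.mul_div_self hp₁]

theorem sum_seriesFlow_left (hE : Disjoint E₁ E₂) (h₁ : ∀ p ∈ P₁, p ⊆ E₁) {m : ℝ}
    {f₁ f₂ : Finset α → ℝ} (F₁ : sFeasible P₁ f₁ m) (F₂ : sFeasible P₂ f₂ m)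
    {p₂ : Finset α} (hp₂ : p₂ ∈ P₂) (hp₂E : p₂ ⊆ E₂) :
    ∑ p₁ ∈ P₁, seriesFlow E₁ E₂ m f₁ f₂ (p₁ ∪ p₂) = f₂ p₂ := by
  rw [Finset.sum_congr rfl fun p₁ hp₁ => seriesFlow_union hE (h₁ p₁ hp₁) hp₂E m f₁ f₂,
    ← Finset.sum_div, ← Finset.sum_mul, F₁.2, mul_comm, F₂.mul_div_self hp₂]

theorem sLoad_series_left (hE : Disjoint E₁ E₂) (h₁ : ∀ p ∈ P₁, p ⊆ E₁)
    (h₂ : ∀ p ∈ P₂, p ⊆ E₂) {m : ℝ} {f₁ f₂ : Finset α → ℝ} (F₁ : sFeasible P₁ f₁ m)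
    (F₂ : sFeasible P₂ f₂ m) {e : α} (he : e ∈ E₁) :
    sLoad ((P₁ ×ˢ P₂).image fun q => q.1 ∪ q.2) (seriesFlow E₁ E₂ m f₁ f₂) e =
      sLoad P₁ f₁ e := by
  rw [sLoad, sum_series_paths hE h₁ h₂]
  refine Finset.sum_congr rfl fun p₁ hp₁ => ?_
  rw [← sum_seriesFlow_right hE h₂ F₁ F₂ hp₁ (h₁ p₁ hp₁)]
  have hiff : ∀ p₂ ∈ P₂, (e ∈ p₁ ∪ p₂ ↔ e ∈ p₁) := fun p₂ hp₂ => by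
    simpa using fun h => absurd (h₂ p₂ hp₂ h) (Finset.disjoint_left.1 hE he)
  rw [Finset.sum_congr rfl fun p₂ hp₂ => if_congr (hiff p₂ hp₂) rfl rfl]
  split_ifs <;> simp

theorem sLoad_series_right (hE : Disjoint E₁ E₂) (h₁ : ∀ p ∈ P₁, p ⊆ E₁)
    (h₂ : ∀ p ∈ P₂, p ⊆ E₂) {m : ℝ} {f₁ f₂ : Finset α → ℝ} (F₁ : sFeasible P₁ f₁ m)
    (F₂ : sFeasible P₂ f₂ m) {e : α} (he : e ∈ E₂) :
    sLoad ((P₁ ×ˢ P₂).image fun q => q.1 ∪ q.2) (seriesFlow E₁ E₂ m f₁ f₂) e =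
      sLoad P₂ f₂ e := by
  rw [sLoad, sum_series_paths hE h₁ h₂, Finset.sum_comm]
  refine Finset.sum_congr rfl fun p₂ hp₂ => ?_
  rw [← sum_seriesFlow_left hE h₁ F₁ F₂ hp₂ (h₂ p₂ hp₂)]
  have hiff : ∀ p₁ ∈ P₁, (e ∈ p₁ ∪ p₂ ↔ e ∈ p₂) := fun p₁ hp₁ => by
    simpa using fun h => absurd he (Finset.disjoint_left.1 hE (h₁ p₁ hp₁ h))
  rw [Finset.sum_congr rfl fun p₁ hp₁ => if_congr (hiff p₁ hp₁) rfl rfl]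
  split_ifs <;> simp

theorem IsMonotoneFamily.series {c : α → ℝ → ℝ} {f₁ f₂ : ℝ → Finset α → ℝ} {L₁ L₂ : ℝ → ℝ}
    (hE : Disjoint E₁ E₂) (h₁ : ∀ p ∈ P₁, p ⊆ E₁) (h₂ : ∀ p ∈ P₂, p ⊆ E₂)
    (H₁ : IsMonotoneFamily E₁ P₁ c f₁ L₁) (H₂ : IsMonotoneFamily E₂ P₂ c f₂ L₂) :
    IsMonotoneFamily (E₁ ∪ E₂) ((P₁ ×ˢ P₂).image fun q => q.1 ∪ q.2) c
      (fun μ => seriesFlow E₁ E₂ (max μ 0) (f₁ μ) (f₂ μ)) (fun μ => L₁ μ + L₂ μ) := by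
  have F₁ : ∀ μ, sFeasible P₁ (f₁ μ) (max μ 0) := fun μ => (H₁.wardrop μ).1
  have F₂ : ∀ μ, sFeasible P₂ (f₂ μ) (max μ 0) := fun μ => (H₂.wardrop μ).1
  set P := (P₁ ×ˢ P₂).image fun q => q.1 ∪ q.2
  set f : ℝ → Finset α → ℝ := fun μ => seriesFlow E₁ E₂ (max μ 0) (f₁ μ) (f₂ μ)
  have flow : ∀ p₁ ∈ P₁, ∀ p₂ ∈ P₂, ∀ μ, f μ (p₁ ∪ p₂) = f₁ μ p₁ * f₂ μ p₂ / max μ 0 :=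
    fun p₁ hp₁ p₂ hp₂ μ => seriesFlow_union hE (h₁ p₁ hp₁) (h₂ p₂ hp₂) _ _ _
  have load₁ : ∀ e ∈ E₁, ∀ μ, sLoad P (f μ) e = sLoad P₁ (f₁ μ) e :=
    fun e he μ => sLoad_series_left hE h₁ h₂ (F₁ μ) (F₂ μ) he
  have load₂ : ∀ e ∈ E₂, ∀ μ, sLoad P (f μ) e = sLoad P₂ (f₂ μ) e :=
    fun e he μ => sLoad_series_right hE h₁ h₂ (F₁ μ) (F₂ μ) he
  have cost : ∀ p₁ ∈ P₁, ∀ p₂ ∈ P₂, ∀ μ, sPathCost P c (f μ) (p₁ ∪ p₂) =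
      sPathCost P₁ c (f₁ μ) p₁ + sPathCost P₂ c (f₂ μ) p₂ := by
    intro p₁ hp₁ p₂ hp₂ μ
    rw [sPathCost, Finset.sum_union (hE.mono (h₁ p₁ hp₁) (h₂ p₂ hp₂))]
    congr 1
    · exact Finset.sum_congr rfl fun e he => by rw [load₁ e (h₁ p₁ hp₁ he)]
    · exact Finset.sum_congr rfl fun e he => by rw [load₂ e (h₂ p₂ hp₂ he)]
  have mem : ∀ p ∈ P, ∃ p₁ ∈ P₁, ∃ p₂ ∈ P₂, p₁ ∪ p₂ = p := by
    intro p hp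
    obtain ⟨⟨p₁, p₂⟩, hq, rfl⟩ := Finset.mem_image.1 hp
    obtain ⟨hp₁, hp₂⟩ := Finset.mem_product.1 hq
    exact ⟨p₁, hp₁, p₂, hp₂, rfl⟩
  refine ⟨?_, ?_, ?_, H₁.cost_mono.add H₂.cost_mono, H₁.cost_cont.add H₂.cost_cont, ?_, ?_⟩
  · intro μ
    refine ⟨⟨fun p hp => ?_, ?_⟩, fun p hp hpos => ?_, fun p hp => ?_⟩
    · obtain ⟨p₁, hp₁, p₂, hp₂, rfl⟩ := mem p hp
      rw [flow p₁ hp₁ p₂ hp₂]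
      exact div_nonneg (mul_nonneg ((F₁ μ).1 p₁ hp₁) ((F₂ μ).1 p₂ hp₂)) (le_max_right μ 0)
    · rw [sum_series_paths hE h₁ h₂, ← (F₁ μ).2]
      exact Finset.sum_congr rfl fun p₁ hp₁ =>
        sum_seriesFlow_right hE h₂ (F₁ μ) (F₂ μ) hp₁ (h₁ p₁ hp₁)
    · obtain ⟨p₁, hp₁, p₂, hp₂, rfl⟩ := mem p hp
      rw [flow p₁ hp₁ p₂ hp₂] at hpos
      have hne : f₁ μ p₁ * f₂ μ p₂ ≠ 0 := fun h => by simp [h] at hpos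
      have pos₁ := ((F₁ μ).1 p₁ hp₁).lt_of_ne' (left_ne_zero_of_mul hne)
      have pos₂ := ((F₂ μ).1 p₂ hp₂).lt_of_ne' (right_ne_zero_of_mul hne)
      rw [cost p₁ hp₁ p₂ hp₂, (H₁.wardrop μ).2.1 p₁ hp₁ pos₁, (H₂.wardrop μ).2.1 p₂ hp₂ pos₂]
    · obtain ⟨p₁, hp₁, p₂, hp₂, rfl⟩ := mem p hp
      rw [cost p₁ hp₁ p₂ hp₂]
      exact add_le_add ((H₁.wardrop μ).2.2 p₁ hp₁) ((H₂.wardrop μ).2.2 p₂ hp₂)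
  · intro e he
    rcases Finset.mem_union.1 he with h | h
    · simpa only [load₁ e h] using H₁.load_mono e h
    · simpa only [load₂ e h] using H₂.load_mono e h
  · intro e he
    rcases Finset.mem_union.1 he with h | h
    · simpa only [load₁ e h] using H₁.load_cont e h
    · simpa only [load₂ e h] using H₂.load_cont e h
  · intro μ
    obtain ⟨p₁, hp₁, e₁⟩ := H₁.tight μ
    obtain ⟨p₂, hp₂, e₂⟩ := H₂.tight μ
    exact ⟨p₁ ∪ p₂, Finset.mem_image.2 ⟨(p₁, p₂), Finset.mem_product.2 ⟨hp₁, hp₂⟩, rfl⟩,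
      by rw [cost p₁ hp₁ p₂ hp₂, e₁, e₂]⟩
  · intro p hp μ ν h hμ
    obtain ⟨p₁, hp₁, p₂, hp₂, rfl⟩ := mem p hp
    rw [cost p₁ hp₁ p₂ hp₂] at hμ ⊢
    have le₁ := (H₁.wardrop μ).2.2 p₁ hp₁
    have le₂ := (H₂.wardrop μ).2.2 p₂ hp₂
    rw [H₁.active_mono p₁ hp₁ μ ν h (by linarith), H₂.active_mono p₂ hp₂ μ ν h (by linarith)]

end Series

theorem IsSP.exists_isMonotoneFamily [DecidableEq α] {E : Finset α} {P : Finset (Finset α)}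
    (hSP : IsSP E P) (c : α → ℝ → ℝ) (hcont : ∀ e ∈ E, Continuous (c e))
    (hmono : ∀ e ∈ E, Monotone (c e)) : ∃ f L, IsMonotoneFamily E P c f L := by
  induction hSP with
  | base e =>
    exact ⟨_, _, .base e c (hcont e (Finset.mem_singleton_self e))
      (hmono e (Finset.mem_singleton_self e))⟩
  | series s₁ s₂ hE ih₁ ih₂ =>
    obtain ⟨f₁, L₁, H₁⟩ := ih₁ (fun e he => hcont e (Finset.mem_union_left _ he))
      fun e he => hmono e (Finset.mem_union_left _ he)
    obtain ⟨f₂, L₂, H₂⟩ := ih₂ (fun e he => hcont e (Finset.mem_union_right _ he))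
      fun e he => hmono e (Finset.mem_union_right _ he)
    exact ⟨_, _, H₁.series hE (fun p hp => (s₁.subset_and_nonempty p hp).1)
      (fun p hp => (s₂.subset_and_nonempty p hp).1) H₂⟩
  | parallel s₁ s₂ hE ih₁ ih₂ =>
    obtain ⟨f₁, L₁, H₁⟩ := ih₁ (fun e he => hcont e (Finset.mem_union_left _ he))
      fun e he => hmono e (Finset.mem_union_left _ he)
    obtain ⟨f₂, L₂, H₂⟩ := ih₂ (fun e he => hcont e (Finset.mem_union_right _ he))
      fun e he => hmono e (Finset.mem_union_right _ he)
    exact H₁.parallel hE s₁.subset_and_nonempty s₂.subset_and_nonempty H₂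

/-- If each point of `B` is the threshold at which some element of `F` enters `T`, then `B` has
at most as many points as `F` has elements. -/
theorem finite_and_ncard_le_of_thresholds {β : Type*} {B : Set ℝ} (F : Finset β) (T : ℝ → Set β)
    (hB : ∀ b ∈ B, 0 < b)
    (h : ∀ b ∈ B, ∃ x ∈ F, (∀ μ, 0 < μ → μ < b → x ∉ T μ) ∧ ∀ μ, b < μ → x ∈ T μ) :
    B.Finite ∧ B.ncard ≤ F.card := by
  rcases B.eq_empty_or_nonempty with rfl | ⟨b₀, hb₀⟩
  · simp
  obtain ⟨x₀, -⟩ := h b₀ hb₀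
  have : Nonempty β := ⟨x₀⟩
  choose! g hgF hg_lt hg_gt using h
  have hinj : Set.InjOn g B := by
    have aux : ∀ a ∈ B, ∀ b ∈ B, g a = g b → ¬ a < b := fun a ha b hb hab hlt => by
      obtain ⟨m, ham, hmb⟩ := exists_between hlt
      exact hg_lt b hb m ((hB a ha).trans ham) hmb (hab ▸ hg_gt a ha m ham)
    exact fun a ha b hb hab =>
      le_antisymm (not_lt.1 (aux b hb a ha hab.symm)) (not_lt.1 (aux a ha b hb hab))
  have hmaps : Set.MapsTo g B (F : Set β) := fun b hb => hgF b hb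
  refine ⟨Set.Finite.of_injOn hmaps hinj F.finite_toSet, ?_⟩
  rw [← Set.ncard_coe_finset F]
  exact Set.ncard_le_ncard_of_injOn g hmaps hinj F.finite_toSet

/-- At a breakpoint of a monotone active network some edge enters the network. -/
theorem IsBreakpoint.exists_entering {Act : ℝ → Set α} {b : ℝ} (h : IsBreakpoint Act b)
    (hmono : MonotoneOn Act (Set.Ioi 0)) :
    ∃ e, (∀ μ, 0 < μ → μ < b → e ∉ Act μ) ∧ ∀ μ, b < μ → e ∈ Act μ := by
  obtain ⟨hb, ε, hε, hleft, hright, hne⟩ := h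
  obtain ⟨m, hm, hmb⟩ := exists_between (max_lt hb (sub_lt_self b hε))
  have hm0 : 0 < m := (le_max_left _ _).trans_lt hm
  have hmε : b - ε < m := (le_max_right _ _).trans_lt hm
  have hb' : 0 < b + ε := by linarith
  rw [← hleft m ⟨hmε.le, hmb⟩] at hne
  have hss : Act m ⊂ Act (b + ε) :=
    (hmono hm0 hb' (by linarith)).lt_of_ne hne
  obtain ⟨e, he, hem⟩ := Set.exists_of_ssubset hss
  refine ⟨e, fun μ hμ hμb heμ => ?_, fun μ hμ => ?_⟩
  · rcases le_total μ m with hle | hle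
    · exact hem (hmono hμ hm0 hle heμ)
    · rw [hleft μ ⟨hmε.le.trans hle, hμb⟩, ← hleft m ⟨hmε.le, hmb⟩] at heμ
      exact hem heμ
  · rcases le_total μ (b + ε) with hle | hle
    · rwa [hright μ ⟨hμ, hle⟩]
    · exact hmono hb' (hb.trans hμ) hle he

/-- in a series-parallel network with continuous, nonnegative, nondecreasing
costs there is a family of Wardrop equilibria with edge loads nondecreasing in the demand;
the active network is nondecreasing (for inclusion) in the demand, and the number of
`Ẽ`-breakpoints is at most `min(|P|, |E|)`. -/
theorem series_parallel_monotone_equilibria [DecidableEq α]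
    (E : Finset α) (P : Finset (Finset α)) (hSP : IsSP E P)
    (c : α → ℝ → ℝ)
    (hc_cont : ∀ e ∈ E, Continuous (c e))
    (hc_nonneg : ∀ e ∈ E, ∀ x, 0 ≤ c e x)
    (hc_mono : ∀ e ∈ E, Monotone (c e)) :
    ∃ (feq : ℝ → Finset α → ℝ) (lamf : ℝ → ℝ),
      (∀ μ : ℝ, 0 ≤ μ → sIsWardrop P c μ (feq μ) (lamf μ)) ∧
      (∀ e ∈ E, MonotoneOn (fun μ => sLoad P (feq μ) e) (Set.Ici 0)) ∧
      MonotoneOn (fun μ => sActive P c (feq μ) (lamf μ)) (Set.Ioi 0) ∧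
      {μ : ℝ | IsBreakpoint (fun ν => sActive P c (feq ν) (lamf ν)) μ}.Finite ∧
      {μ : ℝ | IsBreakpoint (fun ν => sActive P c (feq ν) (lamf ν)) μ}.ncard ≤
        min P.card E.card := by
  obtain ⟨f, L, H⟩ := hSP.exists_isMonotoneFamily c hc_cont hc_mono
  have hact : Monotone fun μ => sActive P c (f μ) (L μ) := by
    rintro μ ν h e ⟨p, hp, hpL, hep⟩
    exact ⟨p, hp, H.active_mono p hp μ ν h hpL, hep⟩
  set B := {μ : ℝ | IsBreakpoint (fun ν => sActive P c (f ν) (L ν)) μ}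
  have enter : ∀ b ∈ B, _ := fun b hb => IsBreakpoint.exists_entering hb (hact.monotoneOn _)
  have hedges : B.Finite ∧ B.ncard ≤ E.card := by
    refine finite_and_ncard_le_of_thresholds E (fun μ => sActive P c (f μ) (L μ))
      (fun b hb => hb.1) fun b hb => ?_
    obtain ⟨e, hlt, hgt⟩ := enter b hb
    obtain ⟨p, hp, -, hep⟩ := hgt (b + 1) (by linarith)
    exact ⟨e, (hSP.subset_and_nonempty p hp).1 hep, hlt, hgt⟩
  have hpaths : B.Finite ∧ B.ncard ≤ P.card := by
    refine finite_and_ncard_le_of_thresholds P (fun μ => {p | sPathCost P c (f μ) p = L μ})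
      (fun b hb => hb.1) fun b hb => ?_
    obtain ⟨e, hlt, hgt⟩ := enter b hb
    by_contra! hnone
    -- Close enough to `b` from the right, no path through `e` would be active.
    have hev : ∀ᶠ μ in nhdsWithin b (Set.Ioi b), ∀ p ∈ P, e ∈ p →
        sPathCost P c (f μ) p ≠ L μ := by
      refine (Filter.eventually_all_finset P).2 fun p hp => ?_
      by_cases hep : e ∈ p
      · obtain ⟨m, hbm, hm⟩ := hnone p hp fun μ hμ hμb hpμ => hlt μ hμ hμb ⟨p, hp, hpμ, hep⟩
        filter_upwards [Ioo_mem_nhdsGT hbm] with μ hμ _ hpμ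
        exact hm (H.active_mono p hp μ m hμ.2.le hpμ)
      · exact Filter.Eventually.of_forall fun μ h => absurd h hep
    obtain ⟨μ, hμ, hbμ⟩ := (hev.and self_mem_nhdsWithin).exists
    obtain ⟨p, hp, hpL, hep⟩ := hgt μ hbμ
    exact hμ p hp hep hpL
  exact ⟨f, L, fun μ hμ => by simpa only [max_eq_left hμ] using H.wardrop μ,
    fun e he => (H.load_mono e he).monotoneOn _, hact.monotoneOn _, hedges.1,
    le_min hpaths.2 hedges.2⟩
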